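/- Let $H$ be a smooth vector field on $\overline{\Omega}_e$ satisfying the escape condition $DH(X,X)\ge |X|_g^2$ for all $X\in\mathbb{R}^3$, where $D$ is the covariant differential of $g=G^{-1}$, and let $w^i$ solve $w^i_{tt}-\operatorname{div}(G\nabla w^i)+w^i=0$ in $\Omega_e\times(0,t)$ for $i=1,2,3$. Then integrating the multiplier identity with multiplier $H(w^i)$ over $\Omega_e\times(0,t)$ and summing over $i$ gives: $2\int_0^t\int_{\Omega_e}\sum_i DH(\nabla_g w^i,\nabla_g w^i)\,dx\,d\tau + \int_0^t\int_{\Omega_e}(|w_t|^2-\langle G\nabla w,\nabla w\rangle-|w|^2)\operatorname{div}H\,dx\,d\tau + \int_0^t\int_{\Gamma_c}(|w|^2+\langle G\nabla w,\nabla w\rangle)\langle H,\nu\rangle\,d\sigma\,d\tau = -2\sum_i\int_{\Omega_e}w_t^i H(w^i)\,dx\Big|_0^t + \int_0^t\int_{\Gamma_c}|w_t|^2\langle H,\nu\rangle\,d\sigma\,d\tau + 2\sum_i\int_0^t\int_{\Gamma_c}H(w^i)(w^i)_{\nu_\Lambda}\,d\sigma\,d\tau$. -/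

import Mathlib

open Matrix MeasureTheory intervalIntegral

noncomputable section

abbrev E3 := Fin 3 → ℝ

noncomputable def pd (i : Fin 3) (f : E3 → ℝ) (x : E3) : ℝ :=
  fderiv ℝ f x (Pi.single i 1)

noncomputable def grad (f : E3 → ℝ) (x : E3) : E3 := fun i => pd i f x

noncomputable def divV (V : E3 → E3) (x : E3) : ℝ :=
  ∑ i : Fin 3, pd i (fun y => V y i) x

/-- Christoffel symbols `Γ^k_{jl}` of the metric `g = G⁻¹`. -/
noncomputable def christoffel (G : E3 → Matrix (Fin 3) (Fin 3) ℝ)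
    (k j l : Fin 3) (x : E3) : ℝ :=
  (1 / 2) * ∑ m : Fin 3, G x k m *
    (pd j (fun y => (G y)⁻¹ m l) x + pd l (fun y => (G y)⁻¹ m j) x
      - pd m (fun y => (G y)⁻¹ j l) x)

/-- Covariant differential `DH(X,Y) = ⟨∇_Y H, X⟩_g` of `H` w.r.t. `g = G⁻¹`. -/
noncomputable def covDiff (G : E3 → Matrix (Fin 3) (Fin 3) ℝ)
    (H : E3 → E3) (x : E3) (X Y : E3) : ℝ :=
  ∑ i : Fin 3, ∑ k : Fin 3, (G x)⁻¹ i k * X i *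
    (∑ j : Fin 3, Y j *
      (pd j (fun y => H y k) x + ∑ l : Fin 3, christoffel G k j l x * H x l))

/-! ### Pure algebra -/

theorem alg_wave (g : Fin 3 → Fin 3 → ℝ) (dg : Fin 3 → Fin 3 → Fin 3 → ℝ) (h : Fin 3 → ℝ)
    (dh : Fin 3 → Fin 3 → ℝ) (p : Fin 3 → ℝ) (dp : Fin 3 → Fin 3 → ℝ) (f u ut : ℝ)
    (du : Fin 3 → ℝ) (hg : ∀ a b, g a b = g b a) (hdp : ∀ a b, dp a b = dp b a)
    (hw : ut - (∑ j, ∑ b, (dg j j b * p b + g j b * dp j b)) + f = 0) :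
    2 * ((∑ k, ∑ j, p k * (∑ b, g j b * p b) * dh j k)
        - (1 / 2) * ∑ l, h l * ∑ a, ∑ b, dg l a b * p a * p b)
      + (u ^ 2 - (∑ a, (∑ b, g a b * p b) * p a) - f ^ 2) * (∑ j, dh j j)
      + (∑ j, ((2 * f * p j + ∑ a, ((∑ b, (dg j a b * p b + g a b * dp j b)) * p a
          + (∑ b, g a b * p b) * dp j a)) * h j
          + (f ^ 2 + ∑ a, (∑ b, g a b * p b) * p a) * dh j j))
      + 2 * (ut * (∑ k, h k * p k) + u * ∑ k, h k * du k)
      - (∑ j, (2 * u * du j * h j + u ^ 2 * dh j j))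
      - 2 * (∑ j, ((∑ k, (dh j k * p k + h k * dp j k)) * (∑ b, g j b * p b)
          + (∑ k, h k * p k) * (∑ b, (dg j j b * p b + g j b * dp j b)))) = 0 := by
  have e : ut = (∑ j, ∑ b, (dg j j b * p b + g j b * dp j b)) - f := by linarith
  subst e
  simp only [Fin.sum_univ_three]
  rw [hg 1 0, hg 2 0, hg 2 1, hdp 1 0, hdp 2 0, hdp 2 1]
  ring

theorem alg_cov (G g : Fin 3 → Fin 3 → ℝ) (dg : Fin 3 → Fin 3 → Fin 3 → ℝ) (h : Fin 3 → ℝ)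
    (dh : Fin 3 → Fin 3 → ℝ) (p X : Fin 3 → ℝ) (hX : ∀ m, ∑ k, p k * G k m = X m)
    (hp : ∀ k, ∑ i, g i k * X i = p k) :
    (∑ i, ∑ k, g i k * X i * (∑ j, X j * (dh j k + ∑ l, ((1 / 2) * ∑ m, G k m *
      (dg j m l + dg l m j - dg m j l)) * h l)))
    = (∑ k, ∑ j, p k * X j * dh j k) + (1 / 2) * ∑ l, h l * ∑ m, ∑ j, X m * dg l m j * X j := by
  have s1 : ∀ Y : Fin 3 → ℝ, (∑ i, ∑ k, g i k * X i * Y k) = ∑ k, p k * Y k := by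
    intro Y
    rw [Finset.sum_comm]
    refine Finset.sum_congr rfl fun k _ => ?_
    rw [← hp k, Finset.sum_mul]
  rw [s1]
  have s2 : ∀ T : Fin 3 → ℝ, (∑ k, p k * ∑ m, G k m * T m) = ∑ m, X m * T m := by
    intro T
    simp only [Finset.mul_sum]
    rw [Finset.sum_comm]
    refine Finset.sum_congr rfl fun k _ => ?_
    rw [← hX k, Finset.sum_mul]
    exact Finset.sum_congr rfl fun _ _ => by ring
  have s3 : (∑ k, p k * (∑ j, X j * (dh j k + ∑ l, ((1 / 2) * ∑ m, G k m *
      (dg j m l + dg l m j - dg m j l)) * h l)))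
      = (∑ k, ∑ j, p k * X j * dh j k) + (1 / 2) * ∑ l, h l * ∑ j, X j *
        (∑ k, p k * ∑ m, G k m * (dg j m l + dg l m j - dg m j l)) := by
    generalize hS : (fun k j l => ∑ m, G k m * (dg j m l + dg l m j - dg m j l)) = S
    have hS' : ∀ k j l, (∑ m, G k m * (dg j m l + dg l m j - dg m j l)) = S k j l := by
      intro k j l; rw [← hS]
    simp only [hS']
    simp only [Fin.sum_univ_three]
    ring
  rw [s3]
  congr 2
  refine Finset.sum_congr rfl fun l _ => ?_
  congr 1
  simp only [s2]
  simp only [Fin.sum_univ_three]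
  ring

theorem inv_entry_diff (G : E3 → Matrix (Fin 3) (Fin 3) ℝ)
    (hGsmooth : ∀ i j : Fin 3, ContDiff ℝ (⊤ : ℕ∞) (fun x => G x i j))
    (hGpos : ∀ x, (G x).PosDef) (a b : Fin 3) : Differentiable ℝ (fun y => (G y)⁻¹ a b) := by
  have hd : ∀ i j, Differentiable ℝ (fun x => G x i j) := fun i j =>
    (hGsmooth i j).differentiable (by simp)
  have hdet : Differentiable ℝ (fun y => (G y).det) := by
    simp only [Matrix.det_fin_three]
    fun_prop
  have hadj : Differentiable ℝ (fun y => (G y).adjugate a b) := by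
    simp only [Matrix.adjugate_fin_three]
    fin_cases a <;> fin_cases b <;> simp <;> fun_prop
  simp only [Matrix.inv_def, Matrix.smul_apply, Ring.inverse_eq_inv', smul_eq_mul]
  exact (hdet.inv fun y => (hGpos y).det_pos.ne').mul hadj

theorem cov_formula (G : E3 → Matrix (Fin 3) (Fin 3) ℝ)
    (hGsmooth : ∀ i j : Fin 3, ContDiff ℝ (⊤ : ℕ∞) (fun x => G x i j))
    (hGsymm : ∀ x, (G x).IsSymm) (hGpos : ∀ x, (G x).PosDef) (H : E3 → E3) (x p : E3) :
    covDiff G H x ((G x).mulVec p) ((G x).mulVec p)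
      = (∑ k, ∑ j, p k * (∑ b, G x j b * p b) * pd j (fun y => H y k) x)
        - (1 / 2) * ∑ l, H x l * ∑ a, ∑ b, pd l (fun y => G y a b) x * p a * p b := by
  have hunit : ∀ y, IsUnit (G y).det := fun y => (hGpos y).det_pos.ne'.isUnit
  have hsymi : ((G x)⁻¹)ᵀ = (G x)⁻¹ := by
    rw [Matrix.transpose_nonsing_inv, (hGsymm x).eq]
  unfold covDiff christoffel
  rw [alg_cov (fun k m => G x k m) (fun i k => (G x)⁻¹ i k)
    (fun c a b => pd c (fun y => (G y)⁻¹ a b) x) (H x) (fun j k => pd j (fun y => H y k) x)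
    p ((G x).mulVec p)]
  · rw [sub_eq_add_neg, ← mul_neg, ← Finset.sum_neg_distrib]
    congr 1
    congr 1
    refine Finset.sum_congr rfl fun l _ => ?_
    rw [← mul_neg]
    congr 1
    -- derivative of the inverse
    let dG : Matrix (Fin 3) (Fin 3) ℝ := fun a b => pd l (fun y => G y a b) x
    let dI : Matrix (Fin 3) (Fin 3) ℝ := fun a b => pd l (fun y => (G y)⁻¹ a b) x
    have key : dG * (G x)⁻¹ + G x * dI = 0 := by
      ext a b
      have h0 : (fun y => ∑ m, G y a m * (G y)⁻¹ m b)
          = fun _ => (1 : Matrix (Fin 3) (Fin 3) ℝ) a b := by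
        funext y
        rw [← Matrix.mul_nonsing_inv (G y) (hunit y), Matrix.mul_apply]
      have h1 : pd l (fun y => ∑ m, G y a m * (G y)⁻¹ m b) x = 0 := by
        rw [h0]; simp [pd]
      have hd1 : ∀ m, DifferentiableAt ℝ (fun y => G y a m) x := fun m =>
        ((hGsmooth a m).differentiable (by simp)) x
      have hd2 : ∀ m, DifferentiableAt ℝ (fun y => (G y)⁻¹ m b) x := fun m =>
        inv_entry_diff G hGsmooth hGpos m b x
      have h2 : pd l (fun y => ∑ m, G y a m * (G y)⁻¹ m b) x
          = ∑ m, (dG a m * (G x)⁻¹ m b + G x a m * dI m b) := by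
        unfold pd
        rw [fderiv_fun_sum (A := fun m y => G y a m * (G y)⁻¹ m b) (fun m _ => (hd1 m).mul (hd2 m))]
        rw [_root_.sum_apply]
        refine Finset.sum_congr rfl fun m _ => ?_
        rw [fderiv_fun_mul (hd1 m) (hd2 m)]
        simp [dG, dI, pd]
        ring
      rw [Matrix.add_apply, Matrix.mul_apply, Matrix.mul_apply, ← Finset.sum_add_distrib, ← h2, h1]
      rfl
    have e1 : (∑ m, ∑ j, (G x).mulVec p m * dI m j * (G x).mulVec p j)
        = (G x).mulVec p ⬝ᵥ dI.mulVec ((G x).mulVec p) := by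
      generalize (G x).mulVec p = Y
      simp only [dotProduct, Matrix.mulVec, Finset.mul_sum, mul_assoc]
    have e2 : (∑ a, ∑ b, dG a b * p a * p b) = p ⬝ᵥ dG.mulVec p := by
      simp only [dotProduct, Matrix.mulVec, Finset.mul_sum]
      exact Finset.sum_congr rfl fun _ _ => Finset.sum_congr rfl fun _ _ => by ring
    change (∑ m, ∑ j, (G x).mulVec p m * dI m j * (G x).mulVec p j)
      = - (∑ a, ∑ b, dG a b * p a * p b)
    rw [e1, e2]
    have e3 : (G x).mulVec p = Matrix.vecMul p (G x) := by
      rw [← Matrix.vecMul_transpose, (hGsymm x).eq]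
    have e4 : G x * dI = - (dG * (G x)⁻¹) := by
      rw [add_comm] at key; exact eq_neg_of_add_eq_zero_left key
    calc (G x).mulVec p ⬝ᵥ dI.mulVec ((G x).mulVec p)
        = p ⬝ᵥ (G x * dI * G x).mulVec p := by
          have e5 : ∀ Y : E3, (G x).mulVec p ⬝ᵥ Y = Matrix.vecMul p (G x) ⬝ᵥ Y := by
            intro Y; rw [e3]
          rw [e5, ← Matrix.dotProduct_mulVec, Matrix.mulVec_mulVec, Matrix.mulVec_mulVec]
      _ = _ := by
          rw [e4, Matrix.neg_mul, Matrix.mul_assoc, Matrix.nonsing_inv_mul _ (hunit x),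
            Matrix.mul_one, Matrix.neg_mulVec, dotProduct_neg]
  · intro m
    simp only [Matrix.mulVec, dotProduct]
    refine Finset.sum_congr rfl fun k _ => ?_
    rw [mul_comm, ← (hGsymm x).apply]
  · intro k
    have : ((G x)⁻¹).mulVec ((G x).mulVec p) = p := by
      rw [Matrix.mulVec_mulVec, Matrix.nonsing_inv_mul _ (hunit x), Matrix.one_mulVec]
    conv_rhs => rw [← this]
    simp only [Matrix.mulVec, dotProduct]
    refine Finset.sum_congr rfl fun i _ => ?_
    conv_lhs => rw [← hsymi]
    rfl

/-! ### Calculus on space-time -/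

/-- directional derivative on space-time -/
def DD (v : E3 × ℝ) (f : E3 × ℝ → ℝ) (z : E3 × ℝ) : ℝ := fderiv ℝ f z v

/-- smoothness on space-time -/
def Sm (f : E3 × ℝ → ℝ) : Prop := ContDiff ℝ (⊤ : ℕ∞) f

def eX (j : Fin 3) : E3 × ℝ := (Pi.single j 1, 0)
def eT : E3 × ℝ := (0, 1)

theorem Sm.diff {f} (h : Sm f) (z) : DifferentiableAt ℝ f z :=
  (ContDiff.differentiable h (by simp)) z

theorem Sm.cont {f} (h : Sm f) : Continuous f := ContDiff.continuous h

theorem Sm.DD {f} (h : Sm f) (v) : Sm (DD v f) := by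
  have h1 : ContDiff ℝ (⊤ : ℕ∞) (fderiv ℝ f) := ContDiff.fderiv_right (m := (⊤ : ℕ∞)) h (by simp)
  exact h1.clm_apply contDiff_const

theorem Sm.mul {f g} (hf : Sm f) (hg : Sm g) : Sm (fun z => f z * g z) := ContDiff.mul hf hg
theorem Sm.add {f g} (hf : Sm f) (hg : Sm g) : Sm (fun z => f z + g z) := ContDiff.add hf hg
theorem Sm.sum {f : Fin 3 → E3 × ℝ → ℝ} (hf : ∀ i, Sm (f i)) : Sm (fun z => ∑ i, f i z) :=
  ContDiff.sum fun i _ => hf i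
theorem Sm.sq {f} (hf : Sm f) : Sm (fun z => f z ^ 2) := ContDiff.pow hf 2
theorem Sm.lift {f : E3 → ℝ} (hf : ContDiff ℝ (⊤ : ℕ∞) f) : Sm (fun z => f z.1) :=
  hf.comp contDiff_fst
theorem Sm.slice {f} (hf : Sm f) (τ : ℝ) : ContDiff ℝ (⊤ : ℕ∞) (fun y => f (y, τ)) :=
  ContDiff.comp (g := f) hf (contDiff_id.prodMk contDiff_const)

theorem DD_mul {f g} (hf : Sm f) (hg : Sm g) (v z) :
    DD v (fun z => f z * g z) z = DD v f z * g z + f z * DD v g z := by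
  unfold DD
  rw [fderiv_fun_mul (hf.diff z) (hg.diff z)]
  simp
  ring

theorem DD_add {f g} (hf : Sm f) (hg : Sm g) (v z) :
    DD v (fun z => f z + g z) z = DD v f z + DD v g z := by
  unfold DD
  rw [fderiv_fun_add (hf.diff z) (hg.diff z)]
  simp

theorem DD_sum {f : Fin 3 → E3 × ℝ → ℝ} (hf : ∀ i, Sm (f i)) (v z) :
    DD v (fun z => ∑ i, f i z) z = ∑ i, DD v (f i) z := by
  unfold DD
  rw [fderiv_fun_sum fun i _ => (hf i).diff z]
  simp

theorem DD_sq {f} (hf : Sm f) (v z) : DD v (fun z => f z ^ 2) z = 2 * f z * DD v f z := by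
  have : (fun z => f z ^ 2) = fun z => f z * f z := by funext z; ring
  rw [this, DD_mul hf hf]; ring

theorem DD_comm {f} (hf : Sm f) (v v' z) : DD v (DD v' f) z = DD v' (DD v f) z := by
  have hs : IsSymmSndFDerivAt ℝ f z := by
    apply ContDiffAt.isSymmSndFDerivAt (n := (⊤ : ℕ∞)) (ContDiff.contDiffAt hf)
    simp only [minSmoothness_of_isRCLikeNormedField]
    exact WithTop.coe_le_coe.2 (le_top : (2 : ℕ∞) ≤ ⊤)
  have hd : DifferentiableAt ℝ (fderiv ℝ f) z :=
    ((ContDiff.fderiv_right (m := (⊤ : ℕ∞)) hf (by simp)).differentiable (by simp)) z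
  have h1 : ∀ a b, DD a (DD b f) z = fderiv ℝ (fderiv ℝ f) z a b := by
    intro a b
    change fderiv ℝ (fun y => fderiv ℝ f y b) z a = _
    rw [fderiv_clm_apply hd (by fun_prop)]
    simp
  rw [h1, h1]
  exact hs v v'

theorem pd_slice {f} (hf : Sm f) (j : Fin 3) (x : E3) (τ : ℝ) :
    pd j (fun y => f (y, τ)) x = DD (eX j) f (x, τ) := by
  unfold pd DD eX
  have h1 : HasFDerivAt (fun y : E3 => (y, τ)) (ContinuousLinearMap.inl ℝ E3 ℝ) x :=
    hasFDerivAt_prodMk_left x τ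
  have h2 := ((hf.diff (x, τ)).hasFDerivAt.comp x h1).fderiv
  simp only [Function.comp_def] at h2
  rw [h2]; simp

theorem hasDeriv_slice {f} (hf : Sm f) (x : E3) (τ : ℝ) :
    HasDerivAt (fun r => f (x, r)) (DD eT f (x, τ)) τ := by
  have h1 : HasDerivAt (fun r : ℝ => (x, r)) ((0 : E3), (1 : ℝ)) τ :=
    (hasDerivAt_const τ x).prodMk (hasDerivAt_id τ)
  exact (hf.diff (x, τ)).hasFDerivAt.comp_hasDerivAt τ h1

theorem pd_lift {f : E3 → ℝ} (hf : ContDiff ℝ (⊤ : ℕ∞) f) (j : Fin 3) (z : E3 × ℝ) :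
    DD (eX j) (fun z => f z.1) z = pd j f z.1 :=
  (pd_slice (Sm.lift hf) j z.1 z.2).symm

/-! ### Integration -/

theorem int_prod {Ω : Set E3} (hb : Bornology.IsBounded Ω) {F : E3 × ℝ → ℝ} (hF : Continuous F)
    (t : ℝ) : Integrable (fun q : ℝ × E3 => F (q.2, q.1))
      ((volume.restrict (Set.uIoc 0 t)).prod (volume.restrict Ω)) := by
  rw [Measure.prod_restrict]
  have hc : IsCompact (Set.uIcc 0 t ×ˢ closure Ω) := isCompact_uIcc.prod hb.isCompact_closure
  have : ContinuousOn (fun q : ℝ × E3 => F (q.2, q.1)) (Set.uIcc 0 t ×ˢ closure Ω) := by fun_prop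
  exact (this.integrableOn_compact hc).mono_set
    (Set.prod_mono Set.uIoc_subset_uIcc subset_closure)

theorem int_slice {Ω : Set E3} (hb : Bornology.IsBounded Ω) {F : E3 × ℝ → ℝ} (hF : Continuous F)
    (τ : ℝ) : Integrable (fun x => F (x, τ)) (volume.restrict Ω) := by
  have : ContinuousOn (fun x : E3 => F (x, τ)) (closure Ω) := by fun_prop
  exact (this.integrableOn_compact hb.isCompact_closure).mono_set subset_closure

theorem int_time {Ω : Set E3} (hb : Bornology.IsBounded Ω) {F : E3 × ℝ → ℝ} (hF : Continuous F)
    (t : ℝ) : IntervalIntegrable (fun τ => ∫ x in Ω, F (x, τ)) volume 0 t := by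
  rw [intervalIntegrable_iff]
  exact (int_prod hb hF t).integral_prod_left

/-- space-time integral -/
def II (Ω : Set E3) (t : ℝ) (F : E3 × ℝ → ℝ) : ℝ := ∫ τ in (0:ℝ)..t, ∫ x in Ω, F (x, τ)

theorem II_add {Ω : Set E3} (hb : Bornology.IsBounded Ω) {F K : E3 × ℝ → ℝ} (hF : Continuous F)
    (hK : Continuous K) (t : ℝ) : II Ω t (fun z => F z + K z) = II Ω t F + II Ω t K := by
  unfold II
  rw [← intervalIntegral.integral_add (int_time hb hF t) (int_time hb hK t)]
  refine intervalIntegral.integral_congr fun τ _ => ?_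
  exact integral_add (int_slice hb hF τ) (int_slice hb hK τ)

theorem II_smul {Ω : Set E3} (c : ℝ) (F : E3 × ℝ → ℝ) (t : ℝ) :
    II Ω t (fun z => c * F z) = c * II Ω t F := by
  unfold II
  rw [← intervalIntegral.integral_const_mul]
  refine intervalIntegral.integral_congr fun τ _ => ?_
  exact integral_const_mul _ _

theorem II_time {Ω : Set E3} (hb : Bornology.IsBounded Ω) {F : E3 × ℝ → ℝ} (hF : Sm F) (t : ℝ) :
    II Ω t (DD eT F) = (∫ x in Ω, F (x, t)) - ∫ x in Ω, F (x, 0) := by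
  unfold II
  rw [intervalIntegral_integral_swap (int_prod hb (hF.DD eT).cont t),
    ← integral_sub (int_slice hb hF.cont t) (int_slice hb hF.cont 0)]
  congr 1
  funext x
  refine intervalIntegral.integral_eq_sub_of_hasDerivAt (fun τ _ => hasDeriv_slice hF x τ) ?_
  have := (hF.DD eT).cont
  exact (by fun_prop : Continuous fun τ => DD eT F (x, τ)).intervalIntegrable _ _

theorem bdry {Ω : Set E3} {σc : Measure E3} {ν : E3 → E3}
    (hdivthm : ∀ V : E3 → E3, (∀ i : Fin 3, ContDiff ℝ (⊤ : ℕ∞) (fun x => V x i)) →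
      (∫ x in Ω, divV V x) = ∫ x, V x ⬝ᵥ ν x ∂σc)
    {V : Fin 3 → E3 × ℝ → ℝ} (hV : ∀ j, Sm (V j)) (t : ℝ) :
    (∫ τ in (0:ℝ)..t, ∫ x, (∑ j, V j (x, τ) * ν x j) ∂σc)
      = II Ω t (fun z => ∑ j, DD (eX j) (V j) z) := by
  unfold II
  refine intervalIntegral.integral_congr fun τ _ => ?_
  have := hdivthm (fun x j => V j (x, τ)) (fun j => (hV j).slice τ)
  simp only [divV, dotProduct, fun x j => pd_slice (hV j) j x τ] at this
  exact this.symm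

/-- Integrated geometric multiplier identity (multiplier `H(wⁱ)`): for solutions
of the wave system `wⁱ_tt - div(G∇wⁱ) + wⁱ = 0` on `Ω_e` one has the boundary
integral identity of the escape-vector-field method. -/
theorem escape_multiplier_identity
    (Ωe : Set E3) (hΩe : IsOpen Ωe) (hbe : Bornology.IsBounded Ωe)
    (σc : Measure E3) [IsFiniteMeasure σc] (ν : E3 → E3)
    (G : E3 → Matrix (Fin 3) (Fin 3) ℝ)
    (hGsmooth : ∀ i j : Fin 3, ContDiff ℝ (⊤ : ℕ∞) (fun x => G x i j))
    (hGsymm : ∀ x, (G x).IsSymm) (hGpos : ∀ x, (G x).PosDef)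
    (H : E3 → E3) (hH : ∀ k : Fin 3, ContDiff ℝ (⊤ : ℕ∞) (fun x => H x k))
    -- escape condition `DH(X,X) ≥ |X|_g²`
    (hesc : ∀ x ∈ closure Ωe, ∀ X : E3,
      (G x)⁻¹.mulVec X ⬝ᵥ X ≤ covDiff G H x X X)
    -- divergence theorem on `Ω_e` with surface measure `σc` and normal `ν`
    (hdivthm : ∀ V : E3 → E3, (∀ i : Fin 3, ContDiff ℝ (⊤ : ℕ∞) (fun x => V x i)) →
      (∫ x in Ωe, divV V x) = ∫ x, V x ⬝ᵥ ν x ∂σc)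
    (T : ℝ) (hT : 0 < T)
    (w : E3 → ℝ → E3)
    (hw : ContDiff ℝ (⊤ : ℕ∞) (fun z : E3 × ℝ => w z.1 z.2))
    (hwave : ∀ x ∈ Ωe, ∀ t ∈ Set.Icc (0 : ℝ) T, ∀ i : Fin 3,
      deriv (fun s => deriv (fun r => w x r i) s) t
        - divV (fun y => (G y).mulVec (grad (fun z => w z t i) y)) x
        + w x t i = 0) :
    ∀ t ∈ Set.Icc (0 : ℝ) T,
      2 * (∫ τ in (0:ℝ)..t, ∫ x in Ωe, ∑ i : Fin 3,
            covDiff G H x ((G x).mulVec (grad (fun z => w z τ i) x))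
              ((G x).mulVec (grad (fun z => w z τ i) x)))
        + (∫ τ in (0:ℝ)..t, ∫ x in Ωe,
            ((∑ i : Fin 3, (deriv (fun r => w x r i) τ) ^ 2)
              - (∑ i : Fin 3, (G x).mulVec (grad (fun z => w z τ i) x) ⬝ᵥ
                  grad (fun z => w z τ i) x)
              - ∑ i : Fin 3, (w x τ i) ^ 2) * divV H x)
        + (∫ τ in (0:ℝ)..t, ∫ x,
            ((∑ i : Fin 3, (w x τ i) ^ 2)
              + ∑ i : Fin 3, (G x).mulVec (grad (fun z => w z τ i) x) ⬝ᵥ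
                  grad (fun z => w z τ i) x) * (H x ⬝ᵥ ν x) ∂σc)
      = -2 * ((∫ x in Ωe, ∑ i : Fin 3,
              deriv (fun r => w x r i) t * (H x ⬝ᵥ grad (fun z => w z t i) x))
            - ∫ x in Ωe, ∑ i : Fin 3,
              deriv (fun r => w x r i) 0 * (H x ⬝ᵥ grad (fun z => w z 0 i) x))
        + (∫ τ in (0:ℝ)..t, ∫ x,
            (∑ i : Fin 3, (deriv (fun r => w x r i) τ) ^ 2) * (H x ⬝ᵥ ν x) ∂σc)
        + 2 * ∫ τ in (0:ℝ)..t, ∫ x, ∑ i : Fin 3,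
            (H x ⬝ᵥ grad (fun z => w z τ i) x) *
              (ν x ⬝ᵥ (G x).mulVec (grad (fun z => w z τ i) x)) ∂σc := by
  intro t ht
  -- basic smooth functions
  obtain ⟨f, hfdef⟩ : ∃ f : Fin 3 → E3 × ℝ → ℝ, ∀ i x τ, w x τ i = f i (x, τ) :=
    ⟨fun i z => w z.1 z.2 i, fun _ _ _ => rfl⟩
  have hf : ∀ i, Sm (f i) := by
    intro i
    have h1 := (contDiff_pi.1 hw) i
    have h2 : f i = fun z : E3 × ℝ => w z.1 z.2 i := by
      funext z; exact (hfdef i z.1 z.2).symm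
    rw [h2]; exact h1
  have hgrad : ∀ τ i x, grad (fun z => w z τ i) x = fun a => DD (eX a) (f i) (x, τ) := by
    intro τ i x; funext a
    simp only [grad, hfdef]
    exact pd_slice (hf i) a x τ
  have hder : ∀ x i τ, deriv (fun r => w x r i) τ = DD eT (f i) (x, τ) := by
    intro x i τ
    simp only [hfdef]
    exact (hasDeriv_slice (hf i) x τ).deriv
  have hGl : ∀ a b, Sm (fun z => G z.1 a b) := fun a b => Sm.lift (hGsmooth a b)
  have hHl : ∀ k, Sm (fun z => H z.1 k) := fun k => Sm.lift (hH k)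
  have hp : ∀ i a, Sm (DD (eX a) (f i)) := fun i a => (hf i).DD _
  have hu : ∀ i, Sm (DD eT (f i)) := fun i => (hf i).DD _
  have hX : ∀ i j, Sm (fun z => ∑ b, G z.1 j b * DD (eX b) (f i) z) := fun i j =>
    Sm.sum fun b => (hGl j b).mul (hp i b)
  have hQ : ∀ i, Sm (fun z => ∑ a, (∑ b, G z.1 a b * DD (eX b) (f i) z) * DD (eX a) (f i) z) :=
    fun i => Sm.sum fun a => (hX i a).mul (hp i a)
  have hHw : ∀ i, Sm (fun z => ∑ k, H z.1 k * DD (eX k) (f i) z) := fun i =>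
    Sm.sum fun k => (hHl k).mul (hp i k)
  -- derivatives
  have dX : ∀ i j v z, DD v (fun z => ∑ b, G z.1 j b * DD (eX b) (f i) z) z
      = ∑ b, (DD v (fun z => G z.1 j b) z * DD (eX b) (f i) z
        + G z.1 j b * DD v (DD (eX b) (f i)) z) := by
    intro i j v z
    rw [DD_sum fun b => (hGl j b).mul (hp i b)]
    exact Finset.sum_congr rfl fun b _ => DD_mul (hGl j b) (hp i b) v z
  have dQ : ∀ i v z, DD v (fun z => ∑ a, (∑ b, G z.1 a b * DD (eX b) (f i) z)
      * DD (eX a) (f i) z) z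
      = ∑ a, ((∑ b, (DD v (fun z => G z.1 a b) z * DD (eX b) (f i) z
        + G z.1 a b * DD v (DD (eX b) (f i)) z)) * DD (eX a) (f i) z
        + (∑ b, G z.1 a b * DD (eX b) (f i) z) * DD v (DD (eX a) (f i)) z) := by
    intro i v z
    rw [DD_sum fun a => (hX i a).mul (hp i a)]
    refine Finset.sum_congr rfl fun a _ => ?_
    rw [DD_mul (hX i a) (hp i a) v z, dX]
  have dHw : ∀ i v z, DD v (fun z => ∑ k, H z.1 k * DD (eX k) (f i) z) z
      = ∑ k, (DD v (fun z => H z.1 k) z * DD (eX k) (f i) z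
        + H z.1 k * DD v (DD (eX k) (f i)) z) := by
    intro i v z
    rw [DD_sum fun b => (hHl b).mul (hp i b)]
    exact Finset.sum_congr rfl fun b _ => DD_mul (hHl b) (hp i b) v z
  -- the wave equation
  have hwave' : ∀ x ∈ Ωe, ∀ τ ∈ Set.Icc (0 : ℝ) T, ∀ i : Fin 3,
      DD eT (DD eT (f i)) (x, τ) - (∑ j, ∑ b, (DD (eX j) (fun z => G z.1 j b) (x, τ)
        * DD (eX b) (f i) (x, τ) + G x j b * DD (eX j) (DD (eX b) (f i)) (x, τ)))
        + f i (x, τ) = 0 := by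
    intro x hx τ hτ i
    have h := hwave x hx τ hτ i
    simp only [hder] at h
    rw [(hasDeriv_slice (hu i) x τ).deriv] at h
    simp only [hgrad, divV, Matrix.mulVec, dotProduct] at h
    rw [hfdef] at h
    have e : ∀ j, pd j (fun y => ∑ b, G y j b * DD (eX b) (f i) (y, τ)) x
        = DD (eX j) (fun z => ∑ b, G z.1 j b * DD (eX b) (f i) z) (x, τ) :=
      fun j => pd_slice (hX i j) j x τ
    simp only [e, dX] at h
    exact h
  -- space-time integrands
  have hC : Sm (fun z => (∑ i, f i z ^ 2) + ∑ i, ∑ a, (∑ b, G z.1 a b * DD (eX b) (f i) z)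
      * DD (eX a) (f i) z) := (Sm.sum fun i => (hf i).sq).add (Sm.sum hQ)
  have hD : Sm (fun z => ∑ i, DD eT (f i) z ^ 2) := Sm.sum fun i => (hu i).sq
  have hEi : ∀ j i, Sm (fun z => (∑ k, H z.1 k * DD (eX k) (f i) z)
      * (∑ b, G z.1 j b * DD (eX b) (f i) z)) := fun j i => (hHw i).mul (hX i j)
  have hE : ∀ j, Sm (fun z => ∑ i, (∑ k, H z.1 k * DD (eX k) (f i) z)
      * (∑ b, G z.1 j b * DD (eX b) (f i) z)) := fun j => Sm.sum (hEi j)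
  have hMi : ∀ i, Sm (fun z => DD eT (f i) z * (∑ k, H z.1 k * DD (eX k) (f i) z)) :=
    fun i => (hu i).mul (hHw i)
  have hM : Sm (fun z => ∑ i, DD eT (f i) z * (∑ k, H z.1 k * DD (eX k) (f i) z)) := Sm.sum hMi
  have hCj := fun j => hC.mul (hHl j)
  have hDj := fun j => hD.mul (hHl j)
  have hdH : ∀ j k, Sm (DD (eX j) (fun z => H z.1 k)) := fun j k => (hHl k).DD _
  have hdG : ∀ l a b, Sm (DD (eX l) (fun z => G z.1 a b)) := fun l a b => (hGl a b).DD _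
  have hKi : ∀ i, Sm (fun z => (∑ k, ∑ j, DD (eX k) (f i) z * (∑ b, G z.1 j b * DD (eX b) (f i) z)
        * DD (eX j) (fun z => H z.1 k) z)
      + (-(1 / 2)) * ∑ l, H z.1 l * ∑ a, ∑ b, DD (eX l) (fun z => G z.1 a b) z
        * DD (eX a) (f i) z * DD (eX b) (f i) z) := by
    intro i
    refine Sm.add ?_ (Sm.mul contDiff_const ?_)
    · exact Sm.sum fun k => Sm.sum fun j => ((hp i k).mul (hX i j)).mul (hdH j k)
    · exact Sm.sum fun l => (hHl l).mul (Sm.sum fun a => Sm.sum fun b =>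
        ((hdG l a b).mul (hp i a)).mul (hp i b))
  have hK := Sm.sum hKi
  have hB : Sm (fun z => ((∑ i, DD eT (f i) z ^ 2)
      + (-1) * ((∑ i, ∑ a, (∑ b, G z.1 a b * DD (eX b) (f i) z) * DD (eX a) (f i) z)
      + ∑ i, f i z ^ 2)) * ∑ j, DD (eX j) (fun z => H z.1 j) z) :=
    (hD.add (Sm.mul contDiff_const ((Sm.sum hQ).add (Sm.sum fun i => (hf i).sq)))).mul
      (Sm.sum fun j => hdH j j)
  have hdC := Sm.sum fun j => (hCj j).DD (eX j)
  have hdD := Sm.sum fun j => (hDj j).DD (eX j)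
  have hdE := Sm.sum fun j => (hE j).DD (eX j)
  have hdM := hM.DD eT
  -- rewriting the goal
  have tA : (∫ τ in (0:ℝ)..t, ∫ x in Ωe, ∑ i : Fin 3,
            covDiff G H x ((G x).mulVec (grad (fun z => w z τ i) x))
              ((G x).mulVec (grad (fun z => w z τ i) x))) = II Ωe t (fun z => ∑ i, ((∑ k, ∑ j, DD (eX k) (f i) z
        * (∑ b, G z.1 j b * DD (eX b) (f i) z) * DD (eX j) (fun z => H z.1 k) z)
      + (-(1 / 2)) * ∑ l, H z.1 l * ∑ a, ∑ b, DD (eX l) (fun z => G z.1 a b) z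
        * DD (eX a) (f i) z * DD (eX b) (f i) z)) := by
    rw [II]
    refine intervalIntegral.integral_congr fun τ _ => ?_
    refine integral_congr_ae (Filter.Eventually.of_forall fun x => ?_)
    dsimp only
    refine Finset.sum_congr rfl fun i _ => ?_
    rw [cov_formula G hGsmooth hGsymm hGpos, hgrad]
    simp only [pd_lift (hH _), pd_lift (hGsmooth _ _)]
    ring
  have tB : (∫ τ in (0:ℝ)..t, ∫ x in Ωe,
            ((∑ i : Fin 3, (deriv (fun r => w x r i) τ) ^ 2)
              - (∑ i : Fin 3, (G x).mulVec (grad (fun z => w z τ i) x) ⬝ᵥ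
                  grad (fun z => w z τ i) x)
              - ∑ i : Fin 3, (w x τ i) ^ 2) * divV H x) = II Ωe t (fun z => ((∑ i, DD eT (f i) z ^ 2)
      + (-1) * ((∑ i, ∑ a, (∑ b, G z.1 a b * DD (eX b) (f i) z) * DD (eX a) (f i) z)
      + ∑ i, f i z ^ 2)) * ∑ j, DD (eX j) (fun z => H z.1 j) z) := by
    rw [II]
    refine intervalIntegral.integral_congr fun τ _ => ?_
    refine integral_congr_ae (Filter.Eventually.of_forall fun x => ?_)
    simp only [hgrad, hder]
    simp only [hfdef, divV, Matrix.mulVec, dotProduct, pd_lift (hH _)]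
    ring
  have tC := bdry hdivthm hCj t
  have tD := bdry hdivthm hDj t
  have tE := bdry hdivthm hE t
  have tM := II_time hbe hM t
  have tC' : (∫ τ in (0:ℝ)..t, ∫ x,
            ((∑ i : Fin 3, (w x τ i) ^ 2)
              + ∑ i : Fin 3, (G x).mulVec (grad (fun z => w z τ i) x) ⬝ᵥ
                  grad (fun z => w z τ i) x) * (H x ⬝ᵥ ν x) ∂σc) = _ :=
    Eq.trans (by
    congr 1; funext τ; congr 1; funext x
    simp only [hgrad]
    simp only [hfdef, Matrix.mulVec, dotProduct]
    rw [Finset.mul_sum]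
    exact Finset.sum_congr rfl fun j _ => by ring) tC
  have tD' : (∫ τ in (0:ℝ)..t, ∫ x,
            (∑ i : Fin 3, (deriv (fun r => w x r i) τ) ^ 2) * (H x ⬝ᵥ ν x) ∂σc) = _ :=
    Eq.trans (by
    congr 1; funext τ; congr 1; funext x
    simp only [hder, dotProduct]
    rw [Finset.mul_sum]
    exact Finset.sum_congr rfl fun j _ => by ring) tD
  have tE' : (∫ τ in (0:ℝ)..t, ∫ x, ∑ i : Fin 3,
            (H x ⬝ᵥ grad (fun z => w z τ i) x) *
              (ν x ⬝ᵥ (G x).mulVec (grad (fun z => w z τ i) x)) ∂σc) = _ :=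
    Eq.trans (by
    congr 1; funext τ; congr 1; funext x
    simp only [hgrad, dotProduct, Matrix.mulVec]
    simp only [Finset.sum_mul (s := Finset.univ) (f := fun i : Fin 3 =>
      (∑ k, H x k * DD (eX k) (f i) (x, τ)) * ∑ b, G x _ b * DD (eX b) (f i) (x, τ))]
    rw [Finset.sum_comm]
    refine Finset.sum_congr rfl fun i _ => ?_
    rw [Finset.mul_sum]
    exact Finset.sum_congr rfl fun j _ => by ring) tE
  have tM' : ((∫ x in Ωe, ∑ i : Fin 3,
              deriv (fun r => w x r i) t * (H x ⬝ᵥ grad (fun z => w z t i) x))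
            - ∫ x in Ωe, ∑ i : Fin 3,
              deriv (fun r => w x r i) 0 * (H x ⬝ᵥ grad (fun z => w z 0 i) x)) = _ :=
    Eq.trans (by
    simp only [hgrad, hder, dotProduct]) tM.symm
  rw [tA, tB, tC', tD', tE', tM']
  have hzero : II Ωe t (fun z => 2 * (∑ i, ((∑ k, ∑ j, DD (eX k) (f i) z
        * (∑ b, G z.1 j b * DD (eX b) (f i) z) * DD (eX j) (fun z => H z.1 k) z)
      + (-(1 / 2)) * ∑ l, H z.1 l * ∑ a, ∑ b, DD (eX l) (fun z => G z.1 a b) z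
        * DD (eX a) (f i) z * DD (eX b) (f i) z))
      + (((∑ i, DD eT (f i) z ^ 2)
      + (-1) * ((∑ i, ∑ a, (∑ b, G z.1 a b * DD (eX b) (f i) z) * DD (eX a) (f i) z)
      + ∑ i, f i z ^ 2)) * (∑ j, DD (eX j) (fun z => H z.1 j) z)
      + ((∑ j, DD (eX j) (fun z => ((∑ i, f i z ^ 2) + ∑ i, ∑ a,
          (∑ b, G z.1 a b * DD (eX b) (f i) z) * DD (eX a) (f i) z) * H z.1 j) z)
      + (2 * DD eT (fun z => ∑ i, DD eT (f i) z * (∑ k, H z.1 k * DD (eX k) (f i) z)) z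
      + ((-1) * (∑ j, DD (eX j) (fun z => (∑ i, DD eT (f i) z ^ 2) * H z.1 j) z)
      + (-2) * (∑ j, DD (eX j) (fun z => ∑ i, (∑ k, H z.1 k * DD (eX k) (f i) z)
      * (∑ b, G z.1 j b * DD (eX b) (f i) z)) z)))))) = 0 := by
    have h0 : ∀ τ ∈ Set.uIcc 0 t, (∫ x in Ωe, (fun z => 2 * (∑ i, ((∑ k, ∑ j, DD (eX k) (f i) z
        * (∑ b, G z.1 j b * DD (eX b) (f i) z) * DD (eX j) (fun z => H z.1 k) z)
      + (-(1 / 2)) * ∑ l, H z.1 l * ∑ a, ∑ b, DD (eX l) (fun z => G z.1 a b) z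
        * DD (eX a) (f i) z * DD (eX b) (f i) z))
      + (((∑ i, DD eT (f i) z ^ 2)
      + (-1) * ((∑ i, ∑ a, (∑ b, G z.1 a b * DD (eX b) (f i) z) * DD (eX a) (f i) z)
      + ∑ i, f i z ^ 2)) * (∑ j, DD (eX j) (fun z => H z.1 j) z)
      + ((∑ j, DD (eX j) (fun z => ((∑ i, f i z ^ 2) + ∑ i, ∑ a,
          (∑ b, G z.1 a b * DD (eX b) (f i) z) * DD (eX a) (f i) z) * H z.1 j) z)
      + (2 * DD eT (fun z => ∑ i, DD eT (f i) z * (∑ k, H z.1 k * DD (eX k) (f i) z)) z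
      + ((-1) * (∑ j, DD (eX j) (fun z => (∑ i, DD eT (f i) z ^ 2) * H z.1 j) z)
      + (-2) * (∑ j, DD (eX j) (fun z => ∑ i, (∑ k, H z.1 k * DD (eX k) (f i) z)
      * (∑ b, G z.1 j b * DD (eX b) (f i) z)) z)))))) (x, τ)) = (fun _ => (0:ℝ)) τ := by
      intro τ hτ
      rw [Set.uIcc_of_le ht.1] at hτ
      have hτT : τ ∈ Set.Icc 0 T := ⟨hτ.1, hτ.2.trans ht.2⟩
      refine setIntegral_eq_zero_of_forall_eq_zero fun x hx => ?_
      have hw' := hwave' x hx τ hτT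
      have alg := fun i => alg_wave (fun a b => G x a b)
        (fun l a b => DD (eX l) (fun z => G z.1 a b) (x, τ)) (H x)
        (fun j k => DD (eX j) (fun z => H z.1 k) (x, τ)) (fun a => DD (eX a) (f i) (x, τ))
        (fun c a => DD (eX c) (DD (eX a) (f i)) (x, τ)) (f i (x, τ)) (DD eT (f i) (x, τ))
        (DD eT (DD eT (f i)) (x, τ)) (fun j => DD (eX j) (DD eT (f i)) (x, τ))
        (fun a b => ((hGsymm x).apply a b).symm) (fun a b => DD_comm (hf i) _ _ _) (hw' i)
      have dC : ∀ j, DD (eX j) (fun z => ((∑ i, f i z ^ 2) + ∑ i, ∑ a,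
          (∑ b, G z.1 a b * DD (eX b) (f i) z) * DD (eX a) (f i) z) * H z.1 j) (x, τ)
          = ∑ i, ((2 * f i (x, τ) * DD (eX j) (f i) (x, τ) +
            ∑ a, ((∑ b, (DD (eX j) (fun z => G z.1 a b) (x, τ) * DD (eX b) (f i) (x, τ)
            + G x a b * DD (eX j) (DD (eX b) (f i)) (x, τ))) * DD (eX a) (f i) (x, τ)
            + (∑ b, G x a b * DD (eX b) (f i) (x, τ)) * DD (eX j) (DD (eX a) (f i)) (x, τ)))
              * H x j
            + (f i (x, τ) ^ 2 + ∑ a, (∑ b, G x a b * DD (eX b) (f i) (x, τ))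
              * DD (eX a) (f i) (x, τ)) * DD (eX j) (fun z => H z.1 j) (x, τ)) := by
        intro j
        rw [DD_mul hC (hHl j), DD_add (Sm.sum fun i => (hf i).sq) (Sm.sum hQ),
          DD_sum fun i => (hf i).sq, DD_sum hQ]
        simp only [dQ, DD_sq (hf _)]
        rw [Finset.sum_add_distrib, ← Finset.sum_mul, ← Finset.sum_mul, Finset.sum_add_distrib,
          Finset.sum_add_distrib]
      have dD : ∀ j, DD (eX j) (fun z => (∑ i, DD eT (f i) z ^ 2) * H z.1 j) (x, τ)
          = ∑ i, (2 * DD eT (f i) (x, τ) * DD (eX j) (DD eT (f i)) (x, τ) * H x j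
            + DD eT (f i) (x, τ) ^ 2 * DD (eX j) (fun z => H z.1 j) (x, τ)) := by
        intro j
        rw [DD_mul hD (hHl j), DD_sum fun i => (hu i).sq]
        simp only [DD_sq (hu _)]
        rw [Finset.sum_add_distrib, ← Finset.sum_mul, ← Finset.sum_mul]
      have dE : ∀ j, DD (eX j) (fun z => ∑ i, (∑ k, H z.1 k * DD (eX k) (f i) z)
          * (∑ b, G z.1 j b * DD (eX b) (f i) z)) (x, τ)
          = ∑ i, ((∑ k, (DD (eX j) (fun z => H z.1 k) (x, τ) * DD (eX k) (f i) (x, τ)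
            + H x k * DD (eX j) (DD (eX k) (f i)) (x, τ)))
              * (∑ b, G x j b * DD (eX b) (f i) (x, τ))
            + (∑ k, H x k * DD (eX k) (f i) (x, τ)) *
              (∑ b, (DD (eX j) (fun z => G z.1 j b) (x, τ) * DD (eX b) (f i) (x, τ)
                + G x j b * DD (eX j) (DD (eX b) (f i)) (x, τ)))) := by
        intro j
        rw [DD_sum (hEi j)]
        refine Finset.sum_congr rfl fun i _ => ?_
        rw [DD_mul (hHw i) (hX i j), dHw, dX]
      have hH0 : ∀ k, DD eT (fun z => H z.1 k) (x, τ) = 0 := by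
        intro k
        exact (hasDeriv_slice (hHl k) x τ).unique (hasDerivAt_const τ (H x k))
      have dM : DD eT (fun z => ∑ i, DD eT (f i) z * (∑ k, H z.1 k * DD (eX k) (f i) z)) (x, τ)
          = ∑ i, (DD eT (DD eT (f i)) (x, τ) * (∑ k, H x k * DD (eX k) (f i) (x, τ))
            + DD eT (f i) (x, τ) * ∑ k, H x k * DD (eX k) (DD eT (f i)) (x, τ)) := by
        rw [DD_sum hMi]
        refine Finset.sum_congr rfl fun i _ => ?_
        rw [DD_mul (hu i) (hHw i), dHw]
        simp only [hH0, zero_mul, zero_add, fun k => DD_comm (hf i) eT (eX k) (x, τ)]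
      simp only [dC, dD, dE, dM]
      have hsum := Finset.sum_eq_zero (s := Finset.univ) fun i _ => alg i
      rw [← hsum]
      rw [Finset.sum_comm (s := Finset.univ) (t := Finset.univ) (f := fun j i =>
        ((2 * f i (x, τ) * DD (eX j) (f i) (x, τ) +
            ∑ a, ((∑ b, (DD (eX j) (fun z => G z.1 a b) (x, τ) * DD (eX b) (f i) (x, τ)
            + G x a b * DD (eX j) (DD (eX b) (f i)) (x, τ))) * DD (eX a) (f i) (x, τ)
            + (∑ b, G x a b * DD (eX b) (f i) (x, τ)) * DD (eX j) (DD (eX a) (f i)) (x, τ)))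
              * H x j
            + (f i (x, τ) ^ 2 + ∑ a, (∑ b, G x a b * DD (eX b) (f i) (x, τ))
              * DD (eX a) (f i) (x, τ)) * DD (eX j) (fun z => H z.1 j) (x, τ)))]
      rw [Finset.sum_comm (s := Finset.univ) (t := Finset.univ) (f := fun j i =>
        (2 * DD eT (f i) (x, τ) * DD (eX j) (DD eT (f i)) (x, τ) * H x j
            + DD eT (f i) (x, τ) ^ 2 * DD (eX j) (fun z => H z.1 j) (x, τ)))]
      rw [Finset.sum_comm (s := Finset.univ) (t := Finset.univ) (f := fun j i =>
        ((∑ k, (DD (eX j) (fun z => H z.1 k) (x, τ) * DD (eX k) (f i) (x, τ)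
            + H x k * DD (eX j) (DD (eX k) (f i)) (x, τ)))
              * (∑ b, G x j b * DD (eX b) (f i) (x, τ))
            + (∑ k, H x k * DD (eX k) (f i) (x, τ)) *
              (∑ b, (DD (eX j) (fun z => G z.1 j b) (x, τ) * DD (eX b) (f i) (x, τ)
                + G x j b * DD (eX j) (DD (eX b) (f i)) (x, τ)))))]
      simp only [Finset.sum_sub_distrib, Finset.sum_add_distrib, ← Finset.mul_sum, ← Finset.sum_mul]
      ring
    unfold II
    rw [intervalIntegral.integral_congr h0]
    simp
  have c2 : ∀ (c : ℝ) {F : E3 × ℝ → ℝ}, Continuous F → Continuous fun z => c * F z :=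
    fun c F hF => continuous_const.mul hF
  have ca : ∀ {F K : E3 × ℝ → ℝ}, Continuous F → Continuous K → Continuous fun z => F z + K z :=
    fun hF hK => hF.add hK
  have k5 := ca (c2 (-1) hdD.cont) (c2 (-2) hdE.cont)
  have k4 := ca (c2 2 hdM.cont) k5
  have k3 := ca hdC.cont k4
  have k2 := ca hB.cont k3
  rw [II_add hbe (c2 2 hK.cont) k2, II_add hbe hB.cont k3, II_add hbe hdC.cont k4,
    II_add hbe (c2 2 hdM.cont) k5, II_add hbe (c2 (-1) hdD.cont) (c2 (-2) hdE.cont),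
    II_smul, II_smul, II_smul, II_smul] at hzero
  linarith
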